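/- arXiv:1710.09853 — 2 statements merged into one kernel-verified Lean document; each statement's English description precedes it below -/
import Mathlib

section
/- Let n ≥ 1 and let E₁, E₂ be complex Hilbert spaces. Let 𝕋ⁿ be the n-torus with its normalized Haar measure, and for j = 1, …, n let φ_j : 𝕋ⁿ → ℂ denote the j-th coordinate character φ_j(e^{iθ₁}, …, e^{iθₙ}) = e^{iθ_j}. If X : L²(𝕋ⁿ; E₁) → L²(𝕋ⁿ; E₂) is a linear isometry such that X(φ_j · f) = φ_j · (X f) for every f ∈ L²(𝕋ⁿ; E₁) and every j = 1, …, n, then the Hilbert dimension of E₁ (the cardinality of any orthonormal Hilbert basis) is at most the Hilbert dimension of E₂. -/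
noncomputable section

open Filter Topology MeasureTheory ContinuousLinearMap

universe u v

/-- An operator is a *shift* if it is an isometry whose adjoint powers tend to zero strongly. -/
def IsShiftOp {H : Type*} [NormedAddCommGroup H] [InnerProductSpace ℂ H] [CompleteSpace H]
    (V : H →L[ℂ] H) : Prop :=
  (∀ f, ‖V f‖ = ‖f‖) ∧
    ∀ f, Tendsto (fun m : ℕ => ‖((ContinuousLinearMap.adjoint V) ^ m) f‖) atTop (nhds 0)

/-- The unilateral shift on `ℓ²(ℕ, W)`: `(S f) 0 = 0`, `(S f) (m+1) = f m`. -/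
def IsUnilateralShift {W : Type*} [NormedAddCommGroup W] [InnerProductSpace ℂ W]
    (S : lp (fun _ : ℕ => W) 2 →L[ℂ] lp (fun _ : ℕ => W) 2) : Prop :=
  ∀ f : lp (fun _ : ℕ => W) 2, (S f) 0 = 0 ∧ ∀ m : ℕ, (S f) (m + 1) = f m

/-- The `i`-th coordinate shift on `ℓ²(ℕⁿ, E)`. -/
def IsCoordShift {n : ℕ} {E : Type*} [NormedAddCommGroup E] [InnerProductSpace ℂ E] (i : Fin n)
    (S : lp (fun _ : Fin n → ℕ => E) 2 →L[ℂ] lp (fun _ : Fin n → ℕ => E) 2) : Prop :=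
  ∀ (f : lp (fun _ : Fin n → ℕ => E) 2) (k : Fin n → ℕ),
    (S f) k = if 1 ≤ k i then f (Function.update k i (k i - 1)) else 0

/-- The model space `ℓ²(ℕ, ℓ²(ℕⁿ, E))`, the ℓ²-model of `H²_{H²_E(𝔻ⁿ)}(𝔻)`. -/
abbrev ModelSpace (n : ℕ) (E : Type u) [NormedAddCommGroup E] [InnerProductSpace ℂ E] :=
  lp (fun _ : ℕ => lp (fun _ : Fin n → ℕ => E) 2) 2

/-- `M_{κᵢ}` acts entrywise on `ℓ²(ℕ, ℓ²(ℕⁿ, E))` by the `i`-th coordinate shift. -/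
def IsKappa {n : ℕ} {E : Type*} [NormedAddCommGroup E] [InnerProductSpace ℂ E] (i : Fin n)
    (M : ModelSpace n E →L[ℂ] ModelSpace n E) : Prop :=
  ∀ (f : ModelSpace n E) (m : ℕ) (k : Fin n → ℕ),
    ((M f) m) k = if 1 ≤ k i then (f m) (Function.update k i (k i - 1)) else 0

/-- `P` is the orthogonal projection of `H` onto `W`. -/
def IsOrthProjOnto {H : Type*} [NormedAddCommGroup H] [InnerProductSpace ℂ H]
    (W : Submodule ℂ H) (P : H →L[ℂ] H) : Prop :=
  ∀ f : H, P f ∈ W ∧ f - P f ∈ Wᗮ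

/-- The Hilbert dimension of `E` is at most that of `F`. -/
def HilbertDimLE (E : Type u) (F : Type v) [NormedAddCommGroup E] [InnerProductSpace ℂ E]
    [NormedAddCommGroup F] [InnerProductSpace ℂ F] : Prop :=
  ∀ (ι₁ : Type u) (ι₂ : Type v), HilbertBasis ι₁ ℂ E → HilbertBasis ι₂ ℂ F →
    Cardinal.lift.{v} (Cardinal.mk ι₁) ≤ Cardinal.lift.{u} (Cardinal.mk ι₂)

/-- The Hilbert dimensions of `E` and `F` agree. -/
def HilbertDimEq (E : Type u) (F : Type v) [NormedAddCommGroup E] [InnerProductSpace ℂ E]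
    [NormedAddCommGroup F] [InnerProductSpace ℂ F] : Prop :=
  ∀ (ι₁ : Type u) (ι₂ : Type v), HilbertBasis ι₁ ℂ E → HilbertBasis ι₂ ℂ F →
    Cardinal.lift.{v} (Cardinal.mk ι₁) = Cardinal.lift.{u} (Cardinal.mk ι₂)

instance : Fact ((0 : ℝ) < 1) := ⟨one_pos⟩

open UnitAddTorus in
/-- Uniqueness of Fourier coefficients for integrable vector-valued functions on the torus. -/
theorem fourier_unique {n : ℕ} {E : Type*} [NormedAddCommGroup E] [NormedSpace ℂ E]
    [CompleteSpace E] (f : (Fin n → AddCircle (1 : ℝ)) → E) (hf : Integrable f volume)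
    (h : ∀ k : Fin n → ℤ, ∫ x, (mFourier k x) • f x = 0) : f =ᵐ[volume] 0 := by
  have hint : ∀ g : C(UnitAddTorus (Fin n), ℂ), Integrable (fun x => g x • f x) volume := by
    intro g
    refine hf.bdd_smul (C := ‖g‖) g.continuous.aestronglyMeasurable ?_
    exact Eventually.of_forall fun x => g.norm_coe_le_norm x
  have hcont : ∀ g : C(UnitAddTorus (Fin n), ℂ), ∫ x, g x • f x = 0 := by
    let L₀ : C(UnitAddTorus (Fin n), ℂ) →ₗ[ℂ] E :=
      { toFun := fun g => ∫ x, g x • f x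
        map_add' := fun g g' => by
          rw [← integral_add (hint g) (hint g')]
          simp [add_smul]
        map_smul' := fun c g => by
          simp only [RingHom.id_apply]
          rw [← integral_smul]
          simp [mul_smul] }
    let L : C(UnitAddTorus (Fin n), ℂ) →L[ℂ] E := L₀.mkContinuous (∫ x, ‖f x‖) (by
      intro g
      change ‖∫ x, g x • f x‖ ≤ _
      rw [mul_comm, ← integral_const_mul]
      refine norm_integral_le_of_norm_le (hf.norm.const_mul _) (Eventually.of_forall fun x => ?_)
      rw [norm_smul]
      exact mul_le_mul_of_nonneg_right (g.norm_coe_le_norm x) (norm_nonneg _))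
    have hle : (Submodule.span ℂ (Set.range <| mFourier (d := Fin n))).topologicalClosure
        ≤ LinearMap.ker L.toLinearMap := by
      refine Submodule.topologicalClosure_minimal _ ?_ L.isClosed_ker
      rw [Submodule.span_le]
      rintro _ ⟨k, rfl⟩
      exact h k
    intro g
    rw [span_mFourier_closure_eq_top] at hle
    exact hle (Submodule.mem_top (x := g))
  refine ae_eq_zero_of_forall_setIntegral_isClosed_eq_zero hf fun s hs => ?_
  let δ : ℕ → ℝ := fun m => 1 / ((m : ℝ) + 1)
  have δpos : ∀ m, 0 < δ m := fun m => Nat.one_div_pos_of_nat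
  have δlim : Tendsto δ atTop (𝓝 0) := tendsto_one_div_add_atTop_nhds_zero_nat
  have hlim := thickenedIndicator_tendsto_indicator_closure δpos δlim s
  rw [tendsto_pi_nhds, hs.closure_eq] at hlim
  let g : ℕ → C(UnitAddTorus (Fin n), ℂ) := fun m =>
    ⟨fun x => (((thickenedIndicator (δpos m) s x : NNReal) : ℝ) : ℂ), by fun_prop⟩
  have key : Tendsto (fun m => ∫ x, g m x • f x) atTop
      (𝓝 (∫ x, s.indicator f x)) := by
    refine tendsto_integral_of_dominated_convergence (fun x => ‖f x‖)
      (fun m => (hint (g m)).aestronglyMeasurable) hf.norm ?_ ?_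
    · intro m
      refine Eventually.of_forall fun x => ?_
      rw [norm_smul]
      refine mul_le_of_le_one_left (norm_nonneg _) ?_
      simp only [g, ContinuousMap.coe_mk, Complex.norm_real, NNReal.norm_eq]
      exact_mod_cast thickenedIndicator_le_one (δpos m) s x
    · refine Eventually.of_forall fun x => ?_
      have h1 : Tendsto (fun m => g m x) atTop
          (𝓝 (((s.indicator (fun _ => (1 : NNReal)) x : NNReal) : ℝ) : ℂ)) :=
        (Complex.continuous_ofReal.tendsto _).comp
          ((NNReal.continuous_coe.tendsto _).comp (hlim x))
      have h2 := h1.smul_const (f x)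
      convert h2 using 2
      by_cases hx : x ∈ s <;> simp [hx]
  simp only [hcont] at key
  rw [← integral_indicator hs.measurableSet]
  exact tendsto_nhds_unique key tendsto_const_nhds

instance torus_prob (n : ℕ) :
    IsProbabilityMeasure (volume : Measure (Fin n → AddCircle (1 : ℝ))) := by
  have : IsProbabilityMeasure (volume : Measure (AddCircle (1 : ℝ))) :=
    ⟨by rw [AddCircle.measure_univ]; simp⟩
  infer_instance

theorem exists_mul {n : ℕ} {E : Type*} [NormedAddCommGroup E] [NormedSpace ℂ E]
    (k : Fin n → ℤ) (f : Lp (α := Fin n → AddCircle (1 : ℝ)) E 2 volume) :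
    ∃ g : Lp (α := Fin n → AddCircle (1 : ℝ)) E 2 volume,
      (g : (Fin n → AddCircle (1 : ℝ)) → E) =ᵐ[volume]
        fun x => UnitAddTorus.mFourier k x • f x := by
  have hm : MemLp (fun x => UnitAddTorus.mFourier k x • f x) 2
      (volume : Measure (Fin n → AddCircle (1 : ℝ))) := by
    refine (Lp.memLp f).of_le
      ((UnitAddTorus.mFourier k).continuous.aestronglyMeasurable.smul
        (Lp.aestronglyMeasurable f)) (Eventually.of_forall fun x => ?_)
    rw [norm_smul]
    refine mul_le_of_le_one_left (norm_nonneg _) ?_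
    exact ((UnitAddTorus.mFourier k).norm_coe_le_norm x).trans UnitAddTorus.mFourier_norm.le
  exact ⟨hm.toLp _, hm.coeFn_toLp⟩

section inter
variable {n : ℕ}
    {E₁ : Type u} [NormedAddCommGroup E₁] [InnerProductSpace ℂ E₁]
    {E₂ : Type v} [NormedAddCommGroup E₂] [InnerProductSpace ℂ E₂]
    (X : Lp (α := Fin n → AddCircle (1 : ℝ)) E₁ 2 volume →ₗᵢ[ℂ]
      Lp (α := Fin n → AddCircle (1 : ℝ)) E₂ 2 volume)

/-- `X` intertwines multiplication by the character `k`. -/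
def InterTw (k : Fin n → ℤ) : Prop :=
  ∀ f g : Lp (α := Fin n → AddCircle (1 : ℝ)) E₁ 2 volume,
    (g : (Fin n → AddCircle (1 : ℝ)) → E₁) =ᵐ[volume]
        (fun x => UnitAddTorus.mFourier k x • f x) →
    (X g : (Fin n → AddCircle (1 : ℝ)) → E₂) =ᵐ[volume]
        fun x => UnitAddTorus.mFourier k x • X f x

theorem InterTw.zero : InterTw X 0 := by
  intro f g h
  have : g = f := by
    apply Lp.ext
    filter_upwards [h] with x hx
    rw [hx, UnitAddTorus.mFourier_zero]; simp
  subst this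
  refine Eventually.of_forall fun x => ?_
  simp [UnitAddTorus.mFourier_zero]

theorem InterTw.add {k l : Fin n → ℤ} (hk : InterTw X k) (hl : InterTw X l) : InterTw X (k + l) := by
  intro f g h
  obtain ⟨f', hf'⟩ := exists_mul l f
  have h1 := hl f f' hf'
  have h2 := hk f' g (by
    filter_upwards [h, hf'] with x hx hx'
    rw [hx, hx', UnitAddTorus.mFourier_add, mul_smul])
  filter_upwards [h1, h2] with x hx hx'
  rw [hx', hx, UnitAddTorus.mFourier_add, mul_smul]

theorem InterTw.neg {k : Fin n → ℤ} (hk : InterTw X k) : InterTw X (-k) := by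
  intro f g h
  have h0 : ∀ x, UnitAddTorus.mFourier k x * UnitAddTorus.mFourier (-k) x = 1 := by
    intro x
    rw [← UnitAddTorus.mFourier_add, add_neg_cancel, UnitAddTorus.mFourier_zero]; rfl
  have h1 := hk g f (by
    filter_upwards [h] with x hx
    rw [hx, ← mul_smul, h0, one_smul])
  filter_upwards [h1] with x hx
  rw [hx, ← mul_smul, mul_comm, h0, one_smul]

theorem InterTw.all (hs : ∀ i, InterTw X (Pi.single i 1)) (k : Fin n → ℤ) : InterTw X k := by
  let S : AddSubgroup (Fin n → ℤ) :=
    { carrier := {k | InterTw X k}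
      add_mem' := fun a b => InterTw.add X a b
      zero_mem' := InterTw.zero X
      neg_mem' := fun a => InterTw.neg X a }
  have hk : k = ∑ i, k i • (Pi.single i 1 : Fin n → ℤ) := by
    ext j
    simp [Finset.sum_apply, Pi.single_apply]
  change k ∈ S
  rw [hk]
  exact sum_mem fun i _ => zsmul_mem (hs i) _

theorem ae_inner (hX : ∀ k, InterTw X k) (u v : E₁) :
    ∀ᵐ x : Fin n → AddCircle (1 : ℝ),
      inner ℂ (X (Lp.const 2 volume u) x) (X (Lp.const 2 volume v) x) = inner ℂ u v := by
  have hi := L2.integrable_inner (𝕜 := ℂ) (X (Lp.const 2 volume u)) (X (Lp.const 2 volume v))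
  have key := fourier_unique (fun x => inner ℂ (X (Lp.const 2 volume u) x)
      (X (Lp.const 2 volume v) x) - inner ℂ u v) (hi.sub (integrable_const _)) (by
    intro k
    obtain ⟨g, hg⟩ := exists_mul k (Lp.const 2 volume v)
    have hXg := hX k _ _ hg
    have h1 := X.inner_map_map (Lp.const 2 volume u) g
    rw [L2.inner_def, L2.inner_def] at h1
    have e1 : ∫ x, UnitAddTorus.mFourier k x • (inner ℂ (X (Lp.const 2 volume u) x)
        (X (Lp.const 2 volume v) x) : ℂ) = ∫ x, inner ℂ (X (Lp.const 2 volume u) x) (X g x) := by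
      refine integral_congr_ae ?_
      filter_upwards [hXg] with x hx
      rw [hx, inner_smul_right, smul_eq_mul]
    have e2 : ∫ x, UnitAddTorus.mFourier k x • (inner ℂ u v : ℂ)
        = ∫ x, inner ℂ ((Lp.const 2 (volume : Measure (Fin n → AddCircle (1 : ℝ))) u) x)
          (g x) := by
      refine integral_congr_ae ?_
      filter_upwards [hg, Lp.coeFn_const (p := 2)
        (μ := (volume : Measure (Fin n → AddCircle (1 : ℝ)))) u, Lp.coeFn_const (p := 2)
        (μ := (volume : Measure (Fin n → AddCircle (1 : ℝ)))) v] with x hx hu hv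
      rw [hx, hu, hv, inner_smul_right, smul_eq_mul]
      rfl
    have hb : ∀ φ : (Fin n → AddCircle (1 : ℝ)) → ℂ, Integrable φ volume →
        Integrable (fun x => UnitAddTorus.mFourier k x • φ x) volume := fun φ hφ =>
      hφ.bdd_smul (C := ‖UnitAddTorus.mFourier k‖)
        (UnitAddTorus.mFourier k).continuous.aestronglyMeasurable
        (Eventually.of_forall fun x => (UnitAddTorus.mFourier k).norm_coe_le_norm x)
    simp only [smul_sub]
    rw [integral_sub (hb _ hi) (hb _ (integrable_const _)), e1, e2, h1, sub_self])
  filter_upwards [key] with x hx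
  exact sub_eq_zero.1 hx

end inter

theorem main_aux {n : ℕ}
    {E₁ : Type u} [NormedAddCommGroup E₁] [InnerProductSpace ℂ E₁]
    {E₂ : Type v} [NormedAddCommGroup E₂] [InnerProductSpace ℂ E₂] [CompleteSpace E₂]
    (X : Lp (α := Fin n → AddCircle (1 : ℝ)) E₁ 2 volume →ₗᵢ[ℂ]
      Lp (α := Fin n → AddCircle (1 : ℝ)) E₂ 2 volume) (hX : ∀ k, InterTw X k) :
    HilbertDimLE E₁ E₂ := by
  classical
  intro ι₁ ι₂ b₁ b₂
  have hae : ∀ i j, ∀ᵐ x : Fin n → AddCircle (1 : ℝ),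
      inner ℂ (X (Lp.const 2 volume (b₁ i)) x) (X (Lp.const 2 volume (b₁ j)) x)
        = if i = j then (1 : ℂ) else 0 := by
    intro i j
    filter_upwards [ae_inner X hX (b₁ i) (b₁ j)] with x hx
    rw [hx, orthonormal_iff_ite.1 b₁.orthonormal]
  rcases finite_or_infinite ι₂ with hfin | hinf
  · have := Fintype.ofFinite ι₂
    have : FiniteDimensional ℂ E₂ := b₂.toOrthonormalBasis.toBasis.finiteDimensional_of_finite
    have hfr : Module.finrank ℂ E₂ = Fintype.card ι₂ :=
      Module.finrank_eq_card_basis b₂.toOrthonormalBasis.toBasis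
    have hs : ∀ s : Finset ι₁, s.card ≤ Fintype.card ι₂ := by
      intro s
      have h1 : ∀ᵐ x : Fin n → AddCircle (1 : ℝ), ∀ i : s, ∀ j : s,
          inner ℂ (X (Lp.const 2 volume (b₁ i)) x) (X (Lp.const 2 volume (b₁ j)) x)
            = if i = j then (1 : ℂ) else 0 := by
        rw [ae_all_iff]; intro i
        rw [ae_all_iff]; intro j
        filter_upwards [hae i j] with x hx
        rw [hx]; simp only [Subtype.coe_inj]
      obtain ⟨x, hx⟩ := h1.exists
      have ho : Orthonormal ℂ (fun i : s => X (Lp.const 2 volume (b₁ i)) x) :=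
        orthonormal_iff_ite.2 hx
      have := ho.linearIndependent.fintype_card_le_finrank
      rwa [hfr, Fintype.card_coe] at this
    have h2 : Cardinal.mk ι₁ ≤ (Fintype.card ι₂ : Cardinal) := by
      rw [← Cardinal.mk_univ]
      exact Cardinal.mk_le_iff_forall_finset_subset_card_le.2 fun s _ => hs s
    rw [Cardinal.mk_fintype ι₂, Cardinal.lift_natCast, ← Cardinal.lift_natCast.{v, u}]
    exact Cardinal.lift_le.2 h2
  · have hF : Orthonormal ℂ (fun i => X (Lp.const 2 volume (b₁ i))) := by
      rw [orthonormal_iff_ite]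
      intro i j
      rw [L2.inner_def, integral_congr_ae (hae i j)]
      simp
    have hex : ∀ i, ∃ p : ι₂ × (Fin n → ℤ),
        inner ℂ (b₂ p.1) (∫ x, UnitAddTorus.mFourier p.2 x •
          X (Lp.const 2 volume (b₁ i)) x) ≠ 0 := by
      intro i
      by_contra! hcon
      have h0 := fourier_unique (fun x => X (Lp.const 2 volume (b₁ i)) x)
        ((Lp.memLp _).integrable (by norm_num)) (by
          intro k
          apply b₂.repr.injective
          ext j
          rw [b₂.repr_apply_apply, hcon (j, k)]
          simp)
      have h1 : X (Lp.const 2 volume (b₁ i)) = 0 := by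
        apply Lp.ext
        filter_upwards [h0, Lp.coeFn_zero E₂ 2
          (volume : Measure (Fin n → AddCircle (1 : ℝ)))] with x hx hx'
        rw [hx, hx']
      exact hF.ne_zero i h1
    choose p hp using hex
    have hcount : ∀ q, (p ⁻¹' {q}).Countable := by
      rintro ⟨j, k⟩
      obtain ⟨g, hg⟩ := exists_mul (-k)
        (Lp.const 2 (volume : Measure (Fin n → AddCircle (1 : ℝ))) (b₂ j))
      have hsum := (hF.inner_products_summable (x := g)).countable_support
      refine hsum.mono ?_
      intro i hi
      have hi' : p i = (j, k) := hi
      have h1 := hp i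
      rw [hi'] at h1
      simp only at h1
      have hint : Integrable (fun x => UnitAddTorus.mFourier k x •
          X (Lp.const 2 volume (b₁ i)) x) volume :=
        ((Lp.memLp (X (Lp.const 2 volume (b₁ i)))).integrable (by norm_num)).bdd_smul
          (C := ‖UnitAddTorus.mFourier k‖)
          (UnitAddTorus.mFourier k).continuous.aestronglyMeasurable
          (Eventually.of_forall fun x => (UnitAddTorus.mFourier k).norm_coe_le_norm x)
      have h2 : inner ℂ g (X (Lp.const 2 volume (b₁ i))) ≠ 0 := by
        convert h1 using 1
        rw [L2.inner_def, ← integral_inner hint]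
        refine integral_congr_ae ?_
        filter_upwards [hg, Lp.coeFn_const (p := 2)
          (μ := (volume : Measure (Fin n → AddCircle (1 : ℝ)))) (b₂ j)] with x hx hx'
        rw [hx, hx', inner_smul_left, inner_smul_right, UnitAddTorus.mFourier_neg]
        simp
      have h3 : inner ℂ (X (Lp.const 2 volume (b₁ i))) g ≠ 0 :=
        fun h0 => h2 (inner_eq_zero_symm.1 h0)
      simpa using h3
    have hc := Cardinal.lift_mk_le_lift_mk_mul_of_lift_mk_preimage_le (c := Cardinal.aleph0) p
      (fun q => by
        rw [Cardinal.lift_le_aleph0]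
        exact (hcount q).le_aleph0)
    refine hc.trans ?_
    have hinf' : Cardinal.aleph0 ≤ Cardinal.lift.{u} (Cardinal.mk ι₂) := by
      rw [Cardinal.aleph0_le_lift]; exact Cardinal.aleph0_le_mk ι₂
    rw [Cardinal.mk_prod, Cardinal.lift_mul]
    have hz : Cardinal.lift.{u} (Cardinal.lift.{v} (Cardinal.mk (Fin n → ℤ)))
        ≤ Cardinal.aleph0 := by
      rw [Cardinal.lift_le_aleph0, Cardinal.lift_le_aleph0]
      exact Cardinal.mk_le_aleph0
    simp only [Cardinal.lift_lift] at *
    refine (mul_le_mul' (mul_le_mul' le_rfl (hz.trans hinf')) hinf').trans ?_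
    simp [Cardinal.mul_eq_self hinf']

/-- If `X : L²(𝕋ⁿ; E₁) → L²(𝕋ⁿ; E₂)` is a linear isometry intertwining the
multiplication operators by all the coordinate characters of the `n`-torus, then the Hilbert
dimension of `E₁` is at most the Hilbert dimension of `E₂`. -/
theorem statement0 (n : ℕ) (hn : 1 ≤ n)
    (E₁ : Type u) [NormedAddCommGroup E₁] [InnerProductSpace ℂ E₁] [CompleteSpace E₁]
    (E₂ : Type v) [NormedAddCommGroup E₂] [InnerProductSpace ℂ E₂] [CompleteSpace E₂]
    (M₁ : Fin n → (Lp (α := Fin n → AddCircle (1 : ℝ)) E₁ 2 volume →L[ℂ]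
      Lp (α := Fin n → AddCircle (1 : ℝ)) E₁ 2 volume))
    (M₂ : Fin n → (Lp (α := Fin n → AddCircle (1 : ℝ)) E₂ 2 volume →L[ℂ]
      Lp (α := Fin n → AddCircle (1 : ℝ)) E₂ 2 volume))
    (hM₁ : ∀ (j : Fin n) (f : Lp (α := Fin n → AddCircle (1 : ℝ)) E₁ 2 volume),
      (M₁ j f : (Fin n → AddCircle (1 : ℝ)) → E₁) =ᵐ[volume]
        fun x => (AddCircle.toCircle (x j) : ℂ) • f x)
    (hM₂ : ∀ (j : Fin n) (f : Lp (α := Fin n → AddCircle (1 : ℝ)) E₂ 2 volume),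
      (M₂ j f : (Fin n → AddCircle (1 : ℝ)) → E₂) =ᵐ[volume]
        fun x => (AddCircle.toCircle (x j) : ℂ) • f x)
    (X : Lp (α := Fin n → AddCircle (1 : ℝ)) E₁ 2 volume →ₗᵢ[ℂ]
      Lp (α := Fin n → AddCircle (1 : ℝ)) E₂ 2 volume)
    (hX : ∀ (j : Fin n) (f : Lp (α := Fin n → AddCircle (1 : ℝ)) E₁ 2 volume),
      X (M₁ j f) = M₂ j (X f)) :
    HilbertDimLE E₁ E₂ := by
  refine main_aux X (InterTw.all X fun j => ?_)
  intro f g h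
  have hch : ∀ x : Fin n → AddCircle (1 : ℝ),
      UnitAddTorus.mFourier (Pi.single j 1) x = (AddCircle.toCircle (x j) : ℂ) := by
    intro x
    rw [UnitAddTorus.mFourier_single, fourier_one]
  have hg : g = M₁ j f := by
    apply Lp.ext
    filter_upwards [h, hM₁ j f] with x hx hx'
    rw [hx, hx', hch]
  rw [hg, hX]
  filter_upwards [hM₂ j (X f)] with x hx
  rw [hx, hch]
end
end

section
/- Let n ≥ 1 and let F be a complex Hilbert space, with H_F = ℓ²(ℕ, ℓ²(ℕⁿ, F)) carrying its unilateral shift M_z and entrywise coordinate-shift operators M_{κ₁}, …, M_{κₙ}. Let S ⊆ H_F be a closed subspace invariant under M_z and all M_{κᵢ}, and set V = M_z|_S and Vᵢ = M_{κᵢ}|_S. Then the (n+1)-tuple (V, V₁, …, Vₙ) is doubly commuting if and only if there exist a complex Hilbert space E and an isometry X : ℓ²(ℕ, ℓ²(ℕⁿ, E)) → H_F satisfying X M_z = M_z X and X M_{κᵢ} = M_{κᵢ} X for all i = 1, …, n and range X = S. Moreover, in this case the Hilbert dimension of E is at most the Hilbert dimension of F. -/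
noncomputable section

open Filter Topology MeasureTheory ContinuousLinearMap

universe u v

namespace DCWold

set_option linter.unusedSectionVars false

section abstractPart

variable {H : Type*} [NormedAddCommGroup H] [InnerProductSpace ℂ H] [CompleteSpace H]

theorem mulA (S T : H →L[ℂ] H) (f : H) : (S * T) f = S (T f) := rfl

theorem inner_iso {V : H →L[ℂ] H} (h : ∀ f, ‖V f‖ = ‖f‖) (x y : H) :
    inner ℂ (V x) (V y) = inner ℂ x y :=
  (LinearMap.norm_map_iff_inner_map_map V).1 h x y

theorem adjoint_iso {V : H →L[ℂ] H} (h : ∀ f, ‖V f‖ = ‖f‖) (x : H) :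
    adjoint V (V x) = x := by
  refine ext_inner_right ℂ fun y => ?_
  rw [adjoint_inner_left, inner_iso h]

theorem adjoint_eq_zero_iff {V : H →L[ℂ] H} (x : H) :
    adjoint V x = 0 ↔ ∀ y, inner ℂ x (V y) = 0 := by
  constructor
  · intro h y
    rw [← adjoint_inner_left, h, inner_zero_left]
  · intro h
    refine ext_inner_right ℂ fun y => ?_
    rw [adjoint_inner_left, h, inner_zero_left]

theorem norm_pow_iso {V : H →L[ℂ] H} (h : ∀ f, ‖V f‖ = ‖f‖) (n : ℕ) (x : H) :
    ‖(V ^ n) x‖ = ‖x‖ := by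
  induction n with
  | zero => simp
  | succ n ih => rw [pow_succ', mulA, h, ih]

/-- criterion for double commutation of two commuting operators, the first an isometry -/
theorem dc_of_ker {V W : H →L[ℂ] H} (hV : ∀ f, ‖V f‖ = ‖f‖)
    (hc : ∀ f, V (W f) = W (V f))
    (hk : ∀ f, adjoint V f = 0 → adjoint V (W f) = 0) (f : H) :
    adjoint V (W f) = W (adjoint V f) := by
  have h1 : adjoint V (f - V (adjoint V f)) = 0 := by
    rw [map_sub, adjoint_iso hV, sub_self]
  have h2 := hk _ h1
  rw [map_sub, map_sub, sub_eq_zero, ← hc, adjoint_iso hV] at h2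
  exact h2

variable {A : Type*} [Fintype A] [DecidableEq A]

/-- monomials in commuting operators, over a finset -/
def mon (V : A → H →L[ℂ] H) (hc : ∀ a b, Commute (V a) (V b)) (s : Finset A) (k : A → ℕ) :
    H →L[ℂ] H :=
  s.noncommProd (fun a => V a ^ k a) (fun a _ b _ _ => (hc a b).pow_pow _ _)

theorem mon_erase (V : A → H →L[ℂ] H) (hc : ∀ a b, Commute (V a) (V b)) (k : A → ℕ) (a : A) :
    mon V hc Finset.univ k = V a ^ k a * mon V hc (Finset.univ.erase a) k :=
  (Finset.mul_noncommProd_erase _ (Finset.mem_univ a) _ _ _).symm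

theorem mon_congr (V : A → H →L[ℂ] H) (hc : ∀ a b, Commute (V a) (V b)) (s : Finset A)
    (k l : A → ℕ) (h : ∀ a ∈ s, k a = l a) : mon V hc s k = mon V hc s l := by
  unfold mon
  exact Finset.noncommProd_congr rfl (fun a ha => by rw [h a ha]) _

theorem mon_succ (V : A → H →L[ℂ] H) (hc : ∀ a b, Commute (V a) (V b)) (k : A → ℕ) (a : A) :
    mon V hc Finset.univ (Function.update k a (k a + 1)) = V a * mon V hc Finset.univ k := by
  rw [mon_erase V hc k a, mon_erase V hc _ a, Function.update_self, pow_succ', mul_assoc]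
  congr 2
  refine mon_congr V hc _ _ _ fun b hb => ?_
  rw [Function.update_of_ne (Finset.ne_of_mem_erase hb)]

theorem mon_norm (V : A → H →L[ℂ] H) (hc : ∀ a b, Commute (V a) (V b))
    (hiso : ∀ a f, ‖V a f‖ = ‖f‖) (s : Finset A) (k : A → ℕ) :
    ∀ f, ‖mon V hc s k f‖ = ‖f‖ := by
  unfold mon
  refine Finset.noncommProd_induction s _ _ (fun T : H →L[ℂ] H => ∀ f, ‖T f‖ = ‖f‖) ?_ ?_ ?_
  · intro S T hS hT f
    rw [mulA, hS, hT]
  · intro f; simp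
  · intro a _ f
    exact norm_pow_iso (hiso a) _ _

theorem mon_ker (V : A → H →L[ℂ] H) (hc : ∀ a b, Commute (V a) (V b))
    (hdc : ∀ a b, a ≠ b → ∀ f, adjoint (V a) (V b f) = V b (adjoint (V a) f))
    (a : A) (k : A → ℕ) :
    ∀ f, adjoint (V a) f = 0 → adjoint (V a) (mon V hc (Finset.univ.erase a) k f) = 0 := by
  unfold mon
  refine Finset.noncommProd_induction _ _ _
    (fun T : H →L[ℂ] H => ∀ f, adjoint (V a) f = 0 → adjoint (V a) (T f) = 0) ?_ ?_ ?_
  · intro S T hS hT f hf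
    exact hS _ (hT _ hf)
  · intro f hf; simpa using hf
  · intro b hb f hf
    have hab : a ≠ b := (Finset.ne_of_mem_erase hb).symm
    induction k b with
    | zero => simpa using hf
    | succ n ih => rw [pow_succ', mulA, hdc a b hab, ih, map_zero]

theorem mon_orth_aux (V : A → H →L[ℂ] H) (hc : ∀ a b, Commute (V a) (V b))
    (hiso : ∀ a f, ‖V a f‖ = ‖f‖)
    (hdc : ∀ a b, a ≠ b → ∀ f, adjoint (V a) (V b f) = V b (adjoint (V a) f))
    (k l : A → ℕ) (a : A) (hkl : k a < l a) (f g : H) (hf : adjoint (V a) f = 0) :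
    inner ℂ (mon V hc Finset.univ k f) (mon V hc Finset.univ l g) = 0 := by
  obtain ⟨d, hd⟩ := Nat.exists_eq_add_of_lt hkl
  rw [mon_erase V hc k a, mon_erase V hc l a, hd, add_assoc, pow_add, mul_assoc, mulA,
    mulA (V a ^ k a),
    inner_iso (norm_pow_iso (hiso a) (k a)), mulA, pow_succ', mulA]
  exact (adjoint_eq_zero_iff _).1 (mon_ker V hc hdc a k f hf) _

theorem mon_orth (V : A → H →L[ℂ] H) (hc : ∀ a b, Commute (V a) (V b))
    (hiso : ∀ a f, ‖V a f‖ = ‖f‖)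
    (hdc : ∀ a b, a ≠ b → ∀ f, adjoint (V a) (V b f) = V b (adjoint (V a) f))
    (k l : A → ℕ) (hkl : k ≠ l) (f g : H) (hf : ∀ a, adjoint (V a) f = 0)
    (hg : ∀ a, adjoint (V a) g = 0) :
    inner ℂ (mon V hc Finset.univ k f) (mon V hc Finset.univ l g) = 0 := by
  obtain ⟨a, ha⟩ := Function.ne_iff.1 hkl
  rcases lt_or_gt_of_ne ha with h | h
  · exact mon_orth_aux V hc hiso hdc k l a h f g (hf a)
  · rw [← inner_conj_symm, mon_orth_aux V hc hiso hdc l k a h g f (hg a), map_zero]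

/-- The density part of the Wold decomposition. -/
theorem wold_dense (V : A → H →L[ℂ] H) (hiso : ∀ a f, ‖V a f‖ = ‖f‖)
    (hc : ∀ a b, Commute (V a) (V b))
    (hdc : ∀ a b, a ≠ b → ∀ f, adjoint (V a) (V b f) = V b (adjoint (V a) f))
    (hpure : ∀ a g, ∀ ε > (0 : ℝ), ∃ N : ℕ, ∀ y, ‖inner ℂ g ((V a ^ N) y)‖ ≤ ε * ‖y‖)
    (L : Submodule ℂ H) (hL : IsClosed (L : Set H)) (hLV : ∀ a, ∀ f ∈ L, V a f ∈ L)
    (hLW : ∀ f, (∀ a, adjoint (V a) f = 0) → f ∈ L) : ∀ f, f ∈ L := by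
  have hadj : ∀ a b f, adjoint (V a) (adjoint (V b) f) = adjoint (V b) (adjoint (V a) f) := by
    intro a b f
    refine ext_inner_right ℂ fun y => ?_
    simp only [adjoint_inner_left]
    have := congrArg (fun T : H →L[ℂ] H => T y) (hc a b).eq
    simp only [mulA] at this
    rw [this]
  have hLpow : ∀ a (n : ℕ), ∀ f ∈ L, (V a ^ n) f ∈ L := by
    intro a n f hf
    induction n with
    | zero => simpa using hf
    | succ n ih => rw [pow_succ', mulA]; exact hLV a _ ih
  have key : ∀ s : Finset A, ∀ f, (∀ a, a ∉ s → adjoint (V a) f = 0) → f ∈ L := by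
    intro s
    induction s using Finset.induction_on with
    | empty => intro f hf; exact hLW f fun a => hf a (by simp)
    | insert a s has ih =>
      intro f hf
      -- all remainders lie in L
      have hker : ∀ n : ℕ, ∀ b, b ∉ insert a s → adjoint (V b) ((adjoint (V a) ^ n) f) = 0 := by
        intro n b hb
        induction n with
        | zero => simpa using hf b hb
        | succ n ihn => rw [pow_succ', mulA, hadj, ihn, map_zero]
      have hrem : ∀ n : ℕ, f - (V a ^ n) ((adjoint (V a) ^ n) f) ∈ L := by
        intro n
        induction n with
        | zero => simp
        | succ n ihn =>
          set g := (adjoint (V a) ^ n) f with hg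
          have h1 : g - V a (adjoint (V a) g) ∈ L := by
            apply ih
            intro b hb
            by_cases hba : b = a
            · subst hba
              rw [map_sub, adjoint_iso (hiso b), sub_self]
            · have hb' : b ∉ insert a s := by simp [hba, hb]
              rw [map_sub, hdc b a hba, hadj, hker n b hb', map_zero, map_zero, sub_zero]
          have h2 := L.add_mem ihn (hLpow a n _ h1)
          have h3 : (adjoint (V a) ^ (n+1)) f = adjoint (V a) g := by
            rw [pow_succ', mulA]
          rw [h3, pow_succ, mulA]
          rw [map_sub] at h2
          convert h2 using 1
          abel
      have hLc : CompleteSpace L := hL.completeSpace_coe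
      rw [← Submodule.orthogonal_orthogonal L, Submodule.mem_orthogonal]
      intro g hg
      have hbound : ∀ n : ℕ, ‖(adjoint (V a) ^ n) f‖ ≤ ‖f‖ := by
        intro n
        induction n with
        | zero => simp
        | succ n ihn =>
          rw [pow_succ', mulA]
          refine le_trans ?_ ihn
          have h1 : ‖adjoint (V a)‖ ≤ 1 := by
            rw [LinearIsometryEquiv.norm_map]
            exact ContinuousLinearMap.opNorm_le_bound _ zero_le_one fun x => by
              rw [hiso a x, one_mul]
          exact ((adjoint (V a)).le_of_opNorm_le h1 _).trans (by rw [one_mul])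
      have hz : ∀ ε > (0 : ℝ), ‖inner ℂ g f‖ ≤ ε * ‖f‖ := by
        intro ε hε
        obtain ⟨N, hN⟩ := hpure a g ε hε
        have h1 : inner ℂ g (f - (V a ^ N) ((adjoint (V a) ^ N) f)) = 0 :=
          (Submodule.mem_orthogonal' _ _).1 hg _ (hrem N)
        rw [inner_sub_right, sub_eq_zero] at h1
        rw [h1]
        exact (hN _).trans (by gcongr; exact hbound N)
      have : ‖inner ℂ g f‖ ≤ 0 := by
        refine le_of_forall_pos_le_add fun δ hδ => ?_
        refine (hz (δ / (‖f‖ + 1)) (by positivity)).trans ?_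
        rw [zero_add, div_mul_eq_mul_div, div_le_iff₀ (by positivity)]
        nlinarith
      exact norm_le_zero_iff.1 this
  exact fun f => key Finset.univ f (by simp)

end abstractPart

theorem wold {A : Type*} [Fintype A] [DecidableEq A] {H : Type u} [NormedAddCommGroup H]
    [InnerProductSpace ℂ H] [CompleteSpace H]
    (V : A → H →L[ℂ] H) (hiso : ∀ a f, ‖V a f‖ = ‖f‖)
    (hc : ∀ a b, Commute (V a) (V b))
    (hdc : ∀ a b, a ≠ b → ∀ f, adjoint (V a) (V b f) = V b (adjoint (V a) f))
    (hpure : ∀ a g, ∀ ε > (0 : ℝ), ∃ N : ℕ, ∀ y, ‖inner ℂ g ((V a ^ N) y)‖ ≤ ε * ‖y‖) :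
    ∃ (ι : Type u) (X : lp (fun _ : A → ℕ => lp (fun _ : ι => ℂ) 2) 2 →ₗᵢ[ℂ] H),
      Function.Surjective X ∧
      (∀ (T : A → (lp (fun _ : A → ℕ => lp (fun _ : ι => ℂ) 2) 2 →L[ℂ]
        lp (fun _ : A → ℕ => lp (fun _ : ι => ℂ) 2) 2)),
        (∀ a k x, T a (lp.single 2 k x) = lp.single 2 (Function.update k a (k a + 1)) x) →
        ∀ a f, X (T a f) = V a (X f)) := by
  let W : Submodule ℂ H := ⨅ a, LinearMap.ker (adjoint (V a)).toLinearMap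
  have hW : ∀ f, f ∈ W ↔ ∀ a, adjoint (V a) f = 0 := by
    intro f; simp [W, Submodule.mem_iInf]
  have hWc : IsClosed (W : Set H) := by
    have : (W : Set H) = ⋂ a, {f | adjoint (V a) f = 0} := by
      ext f; simp [hW]
    rw [this]
    exact isClosed_iInter fun a => isClosed_eq (adjoint (V a)).continuous continuous_const
  have : CompleteSpace W := hWc.completeSpace_coe
  obtain ⟨w, b, hb⟩ := exists_hilbertBasis ℂ W
  let J : (A → ℕ) → (lp (fun _ : w => ℂ) 2 →ₗᵢ[ℂ] H) := fun k =>
    { toLinearMap := (mon V hc Finset.univ k).toLinearMap ∘ₗ W.subtype ∘ₗ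
        b.repr.symm.toLinearEquiv.toLinearMap
      norm_map' := fun x => by
        change ‖mon V hc Finset.univ k (b.repr.symm x : W)‖ = ‖x‖
        rw [mon_norm V hc hiso]
        exact b.repr.symm.norm_map x }
  have hJ : ∀ k x, J k x = mon V hc Finset.univ k (b.repr.symm x : W) := fun k x => rfl
  have horth : OrthogonalFamily ℂ (fun _ : A → ℕ => lp (fun _ : w => ℂ) 2) J := by
    intro k l hkl x y
    rw [hJ, hJ]
    exact mon_orth V hc hiso hdc k l hkl _ _ ((hW _).1 (b.repr.symm x).2)
      ((hW _).1 (b.repr.symm y).2)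
  have hinter : ∀ a k x, horth.linearIsometry (lp.single 2 (Function.update k a (k a + 1)) x)
      = V a (horth.linearIsometry (lp.single 2 k x)) := by
    intro a k x
    rw [horth.linearIsometry_apply_single, horth.linearIsometry_apply_single, hJ, hJ, mon_succ,
      mulA]
  refine ⟨w, horth.linearIsometry, ?_, ?_⟩
  · have := wold_dense V hiso hc hdc hpure
      (⨆ i, LinearMap.range (J i).toLinearMap).topologicalClosure
      (Submodule.isClosed_topologicalClosure _) ?_ ?_
    · intro f
      have h1 := this f
      rw [← horth.range_linearIsometry] at h1
      exact h1
    · intro a f hf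
      have h1 : (⨆ i, LinearMap.range (J i).toLinearMap).topologicalClosure ≤
          ((⨆ i, LinearMap.range (J i).toLinearMap).topologicalClosure).comap
            (V a).toLinearMap := by
        apply Submodule.topologicalClosure_minimal
        · refine iSup_le fun k => ?_
          rintro _ ⟨x, rfl⟩
          rw [Submodule.mem_comap]
          apply Submodule.le_topologicalClosure
          refine Submodule.mem_iSup_of_mem (Function.update k a (k a + 1)) ⟨x, ?_⟩
          change J _ x = V a (J k x)
          rw [hJ, hJ, mon_succ, mulA]
        · exact (Submodule.isClosed_topologicalClosure _).preimage (V a).continuous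
      exact h1 hf
    · intro f hf
      apply Submodule.le_topologicalClosure
      refine Submodule.mem_iSup_of_mem 0 ⟨b.repr ⟨f, (hW f).2 hf⟩, ?_⟩
      change J _ _ = f
      rw [hJ]
      have h1 : mon V hc Finset.univ 0 = 1 :=
        (Finset.noncommProd_eq_pow_card _ _ _ 1 (fun a _ => pow_zero _)).trans (one_pow _)
      rw [h1]
      simp
  · intro T hT a f
    have h1 := (lp.hasSum_single (p := 2) (by simp) f)
    have h2 : HasSum (fun k => horth.linearIsometry (T a (lp.single 2 k (f k))))
      (horth.linearIsometry (T a f)) :=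
      h1.map (horth.linearIsometry.toContinuousLinearMap ∘L T a)
        (horth.linearIsometry.toContinuousLinearMap ∘L T a).continuous
    have h3 : HasSum (fun k => V a (horth.linearIsometry (lp.single 2 k (f k))))
      (V a (horth.linearIsometry f)) :=
      h1.map (V a ∘L horth.linearIsometry.toContinuousLinearMap)
        (V a ∘L horth.linearIsometry.toContinuousLinearMap).continuous
    simp only [hT, hinter] at h2
    exact h2.unique h3

section shifts

variable {A : Type*} [Fintype A] [DecidableEq A]
variable {E : Type*} [NormedAddCommGroup E] [InnerProductSpace ℂ E]

/-- `T` is the shift in direction `a` on `ℓ²(ℕ^A, E)` -/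
def IsSh (a : A) (T : lp (fun _ : A → ℕ => E) 2 →L[ℂ] lp (fun _ : A → ℕ => E) 2) : Prop :=
  ∀ (f : lp (fun _ : A → ℕ => E) 2) (k : A → ℕ),
    (T f) k = if 1 ≤ k a then f (Function.update k a (k a - 1)) else 0

/-- increase coordinate `a` by one -/
def up (a : A) (k : A → ℕ) : A → ℕ := Function.update k a (k a + 1)

theorem up_inj (a : A) : Function.Injective (up a) := by
  intro k l h
  funext b
  have h1 := congrFun h b
  by_cases hb : b = a
  · subst hb; simpa [up] using h1
  · simpa [up, hb] using h1

theorem up_down (a : A) (k : A → ℕ) : Function.update (up a k) a (up a k a - 1) = k := by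
  simp [up]

theorem down_up (a : A) (k : A → ℕ) (h : 1 ≤ k a) :
    up a (Function.update k a (k a - 1)) = k := by
  simp [up, Nat.sub_add_cancel h]

theorem mem_range_up (a : A) (k : A → ℕ) : k ∈ Set.range (up a) ↔ 1 ≤ k a := by
  constructor
  · rintro ⟨l, rfl⟩; simp [up]
  · intro h; exact ⟨_, down_up a k h⟩

theorem IsSh.up {a : A} {T : lp (fun _ : A → ℕ => E) 2 →L[ℂ] lp (fun _ : A → ℕ => E) 2}
    (h : IsSh a T) (f : lp (fun _ : A → ℕ => E) 2) (k : A → ℕ) : (T f) (up a k) = f k := by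
  rw [h, if_pos (by simp [DCWold.up]), up_down]

theorem IsSh.zero {a : A} {T : lp (fun _ : A → ℕ => E) 2 →L[ℂ] lp (fun _ : A → ℕ => E) 2}
    (h : IsSh a T) (f : lp (fun _ : A → ℕ => E) 2) (k : A → ℕ) (hk : k a = 0) : (T f) k = 0 := by
  rw [h, if_neg (by simp [hk])]

theorem hasSum_sq {ι : Type*} {G : ι → Type*} [∀ i, NormedAddCommGroup (G i)] (f : lp G 2) :
    HasSum (fun i => ‖f i‖ ^ 2) (‖f‖ ^ 2) := by
  have := lp.hasSum_norm (p := 2) (by simp) f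
  simpa using this

theorem norm_eq_of_hasSum {ι : Type*} {G : ι → Type*} [∀ i, NormedAddCommGroup (G i)] (f : lp G 2)
    {c : ℝ} (hc : 0 ≤ c) (h : HasSum (fun i => ‖f i‖ ^ 2) (c ^ 2)) : ‖f‖ = c := by
  have := (hasSum_sq f).unique h
  exact (pow_left_inj₀ (norm_nonneg _) hc two_ne_zero).1 this

theorem memlp_sq {ι : Type*} {G : ι → Type*} [∀ i, NormedAddCommGroup (G i)] (f : ∀ i, G i)
    (h : Summable fun i => ‖f i‖ ^ 2) : Memℓp f 2 := by
  refine memℓp_gen ?_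
  simpa using h

theorem hasSum_shift (a : A) (f : (A → ℕ) → E) {c : ℝ} (h : HasSum (fun k => ‖f k‖ ^ 2) c) :
    HasSum (fun k : A → ℕ =>
      ‖(if 1 ≤ k a then f (Function.update k a (k a - 1)) else 0)‖ ^ 2) c := by
  rw [← (up_inj a).hasSum_iff]
  · convert h using 2 with k
    rw [Function.comp_apply, if_pos (by simp [up]), up_down]
  · intro k hk
    rw [mem_range_up] at hk
    simp [hk]

theorem IsSh.norm {a : A} {T : lp (fun _ : A → ℕ => E) 2 →L[ℂ] lp (fun _ : A → ℕ => E) 2}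
    (h : IsSh a T) (f : lp (fun _ : A → ℕ => E) 2) : ‖T f‖ = ‖f‖ := by
  refine norm_eq_of_hasSum _ (norm_nonneg _) ?_
  simp only [h f]
  exact hasSum_shift a f (hasSum_sq f)

theorem exists_sh (E : Type*) [NormedAddCommGroup E] [InnerProductSpace ℂ E] (a : A) :
    ∃ T : lp (fun _ : A → ℕ => E) 2 →L[ℂ] lp (fun _ : A → ℕ => E) 2, IsSh a T := by
  let T0 : lp (fun _ : A → ℕ => E) 2 →ₗ[ℂ] lp (fun _ : A → ℕ => E) 2 :=
    { toFun := fun f => ⟨fun k => if 1 ≤ k a then f (Function.update k a (k a - 1)) else 0,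
        memlp_sq _ (hasSum_shift a f (hasSum_sq f)).summable⟩
      map_add' := fun f g => by
        ext k
        change (if 1 ≤ k a then (f + g) (Function.update k a (k a - 1)) else 0) =
          (if 1 ≤ k a then f (Function.update k a (k a - 1)) else 0) +
          (if 1 ≤ k a then g (Function.update k a (k a - 1)) else 0)
        split_ifs <;> simp
      map_smul' := fun c f => by
        ext k
        change (if 1 ≤ k a then (c • f) (Function.update k a (k a - 1)) else 0) =
          c • (if 1 ≤ k a then f (Function.update k a (k a - 1)) else 0)
        split_ifs <;> simp }
  let T1 : lp (fun _ : A → ℕ => E) 2 →ₗᵢ[ℂ] lp (fun _ : A → ℕ => E) 2 :=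
    { T0 with
      norm_map' := fun f => by
        refine norm_eq_of_hasSum _ (norm_nonneg _) ?_
        exact hasSum_shift a f (hasSum_sq f) }
  exact ⟨T1.toContinuousLinearMap, fun f k => rfl⟩

theorem IsSh.single {a : A} {T : lp (fun _ : A → ℕ => E) 2 →L[ℂ] lp (fun _ : A → ℕ => E) 2}
    (h : IsSh a T) (k : A → ℕ) (x : E) :
    T (lp.single 2 k x) = lp.single 2 (DCWold.up a k) x := by
  ext l
  by_cases hl : 1 ≤ l a
  · obtain ⟨m, rfl⟩ := (mem_range_up a l).2 hl
    rw [h.up, lp.single_apply, lp.single_apply]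
    by_cases hm : m = k
    · subst hm; simp
    · rw [Pi.single_eq_of_ne hm, Pi.single_eq_of_ne fun h' => hm (up_inj a h')]
  · rw [h.zero _ _ (by omega), lp.single_apply_ne]
    rintro rfl
    simp [DCWold.up] at hl

theorem IsSh.comm {a b : A} {T T' : lp (fun _ : A → ℕ => E) 2 →L[ℂ] lp (fun _ : A → ℕ => E) 2}
    (h : IsSh a T) (h' : IsSh b T') (f : lp (fun _ : A → ℕ => E) 2) : T (T' f) = T' (T f) := by
  ext k
  by_cases hab : a = b
  · subst hab
    have : T = T' := by
      ext g l
      rw [h, h']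
    rw [this]
  · rw [h, h', h', h, Function.update_of_ne hab, Function.update_of_ne (Ne.symm hab),
      Function.update_comm hab]
    split_ifs <;> rfl

theorem IsSh.pow_zero [CompleteSpace E] {a : A}
    {T : lp (fun _ : A → ℕ => E) 2 →L[ℂ] lp (fun _ : A → ℕ => E) 2}
    (h : IsSh a T) (N : ℕ) : ∀ (f : lp (fun _ : A → ℕ => E) 2) (k : A → ℕ), k a < N →
      ((T ^ N) f) k = 0 := by
  induction N with
  | zero => intro f k hk; omega
  | succ N ih =>
    intro f k hk
    rw [pow_succ', mulA, h]
    split_ifs with h1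
    · apply ih
      rw [Function.update_self]; omega
    · rfl

theorem IsSh.pure [CompleteSpace E] {a : A}
    {T : lp (fun _ : A → ℕ => E) 2 →L[ℂ] lp (fun _ : A → ℕ => E) 2}
    (h : IsSh a T) (g : lp (fun _ : A → ℕ => E) 2) (ε : ℝ) (hε : 0 < ε) :
    ∃ N : ℕ, ∀ y, ‖inner ℂ g ((T ^ N) y)‖ ≤ ε * ‖y‖ := by
  have h1 := (lp.hasSum_single (p := 2) (by simp) g)
  obtain ⟨s, hs⟩ := ((Metric.tendsto_nhds.1 h1) ε hε).exists
  refine ⟨s.sup (fun k => k a) + 1, fun y => ?_⟩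
  set N := s.sup (fun k => k a) + 1
  have h2 : inner ℂ (∑ k ∈ s, lp.single 2 k (g k)) ((T ^ N) y) = (0 : ℂ) := by
    rw [sum_inner]
    refine Finset.sum_eq_zero fun k hk => ?_
    rw [lp.inner_single_left, h.pow_zero N y k, inner_zero_right]
    exact Nat.lt_succ_of_le (Finset.le_sup (f := fun k : A → ℕ => k a) hk)
  have h3 : inner ℂ g ((T ^ N) y) =
      inner ℂ (g - ∑ k ∈ s, lp.single 2 k (g k)) ((T ^ N) y) := by
    rw [inner_sub_left, h2, sub_zero]
  rw [h3]
  refine (norm_inner_le_norm _ _).trans ?_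
  rw [norm_pow_iso h.norm]
  gcongr
  rw [dist_comm, dist_eq_norm] at hs
  exact hs.le

theorem IsSh.ker {a b : A} (hab : a ≠ b)
    {T T' : lp (fun _ : A → ℕ => E) 2 →L[ℂ] lp (fun _ : A → ℕ => E) 2}
    (h : IsSh a T) (h' : IsSh b T') (f : lp (fun _ : A → ℕ => E) 2)
    (hf : ∀ g, inner ℂ f (T g) = 0) (g : lp (fun _ : A → ℕ => E) 2) :
    inner ℂ (T' f) (T g) = 0 := by
  have h0 : ∀ k, 1 ≤ k a → f k = 0 := by
    intro k hk
    obtain ⟨l, rfl⟩ := (mem_range_up a k).2 hk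
    have := hf (lp.single 2 l (f (DCWold.up a l)))
    rw [h.single, lp.inner_single_right] at this
    exact inner_self_eq_zero.1 this
  rw [lp.inner_eq_tsum]
  refine (tsum_congr fun k => ?_).trans tsum_zero
  by_cases hk : 1 ≤ k a
  · have : (T' f) k = 0 := by
      rw [h']
      split_ifs
      · apply h0
        rwa [Function.update_of_ne hab]
      · rfl
    rw [this, inner_zero_left]
  · rw [h.zero g k (by omega), inner_zero_right]

end shifts

section dimension

open scoped ENNReal

theorem card_lemma {ι₁ : Type u} {ι₂ : Type v} (M : ι₁ → ι₂ → ℝ≥0∞)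
    (h1 : ∀ j, ∑' b, M j b = 1) (h2 : ∀ b, ∑' j, M j b ≤ 1) :
    Cardinal.lift.{v} (Cardinal.mk ι₁) ≤ Cardinal.lift.{u} (Cardinal.mk ι₂) := by
  rcases finite_or_infinite ι₂ with hfin | hinf
  · have := Fintype.ofFinite ι₂
    have h3 : Cardinal.mk ι₁ ≤ (Fintype.card ι₂ : ℕ) := by
      refine Cardinal.card_le_of fun s => ?_
      have : (s.card : ℝ≥0∞) ≤ (Fintype.card ι₂ : ℕ) := by
        calc (s.card : ℝ≥0∞) = ∑ j ∈ s, ∑' b, M j b := by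
              simp only [h1]; simp
          _ ≤ ∑' j, ∑' b, M j b := ENNReal.sum_le_tsum s
          _ = ∑' b, ∑' j, M j b := ENNReal.tsum_comm
          _ = ∑ b, ∑' j, M j b := tsum_fintype _
          _ ≤ ∑ b : ι₂, 1 := Finset.sum_le_sum fun b _ => h2 b
          _ = (Fintype.card ι₂ : ℕ) := by simp
      exact_mod_cast this
    have h4 := Cardinal.lift_le.{v}.2 h3
    rw [Cardinal.mk_fintype ι₂]
    simpa using h4
  · have hex : ∀ j, ∃ b, M j b ≠ 0 := by
      intro j
      by_contra! hcon
      have := h1 j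
      simp [hcon] at this
    choose φ hφ using hex
    have h3 := Cardinal.lift_mk_le_lift_mk_mul_of_lift_mk_preimage_le (c := Cardinal.aleph0) φ ?_
    · refine h3.trans ?_
      rw [Cardinal.mul_aleph0_eq]
      simp
    · intro b
      have hne : ∑' j, M j b ≠ ∞ := ne_top_of_le_ne_top ENNReal.one_ne_top (h2 b)
      have hc := Summable.countable_support_ennreal hne
      have hsub : φ ⁻¹' {b} ⊆ Function.support fun j => M j b := by
        rintro j rfl
        exact hφ j
      have := (hc.mono hsub).le_aleph0
      simpa using this

variable {A : Type*} [Fintype A] [DecidableEq A]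

theorem shift_invariance {E F : Type*} [NormedAddCommGroup E] [InnerProductSpace ℂ E]
    [NormedAddCommGroup F] [InnerProductSpace ℂ F]
    (X : lp (fun _ : A → ℕ => E) 2 →ₗᵢ[ℂ] lp (fun _ : A → ℕ => F) 2)
    (TE : A → lp (fun _ : A → ℕ => E) 2 →L[ℂ] lp (fun _ : A → ℕ => E) 2)
    (TF : A → lp (fun _ : A → ℕ => F) 2 →L[ℂ] lp (fun _ : A → ℕ => F) 2)
    (hTE : ∀ a, IsSh a (TE a)) (hTF : ∀ a, IsSh a (TF a))
    (hX : ∀ a f, X (TE a f) = TF a (X f)) (x : E) (m : A → ℕ) :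
    ∀ l k, (X (lp.single 2 (l + m) x)) (k + m) = (X (lp.single 2 l x)) k := by
  have hup : ∀ a (k : A → ℕ), k + Pi.single a 1 = up a k := by
    intro a k
    funext b
    by_cases hb : b = a
    · subst hb; simp [up]
    · simp [up, hb]
  have hm : m = ∑ a, Pi.single a (m a) := (Finset.univ_sum_single m).symm
  rw [hm]
  refine Finset.sum_induction _ (fun m : A → ℕ =>
    ∀ l k, (X (lp.single 2 (l + m) x)) (k + m) = (X (lp.single 2 l x)) k) ?_ ?_ ?_
  · intro p q hp hq l k
    rw [← add_assoc, ← add_assoc, hq, hp]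
  · intro l k
    simp
  · intro a _
    induction m a with
    | zero => intro l k; simp
    | succ n ih =>
      intro l k
      rw [Pi.single_add, ← add_assoc, ← add_assoc, hup, hup, ← (hTE a).single, hX, (hTF a).up, ih]

theorem dim_le {E : Type u} {F : Type v} [NormedAddCommGroup E] [InnerProductSpace ℂ E]
    [NormedAddCommGroup F] [InnerProductSpace ℂ F]
    (X : lp (fun _ : A → ℕ => E) 2 →ₗᵢ[ℂ] lp (fun _ : A → ℕ => F) 2)
    (TE : A → lp (fun _ : A → ℕ => E) 2 →L[ℂ] lp (fun _ : A → ℕ => E) 2)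
    (TF : A → lp (fun _ : A → ℕ => F) 2 →L[ℂ] lp (fun _ : A → ℕ => F) 2)
    (hTE : ∀ a, IsSh a (TE a)) (hTF : ∀ a, IsSh a (TF a))
    (hX : ∀ a f, X (TE a f) = TF a (X f))
    {ι₁ : Type u} {ι₂ : Type v} (e : HilbertBasis ι₁ ℂ E) (f : HilbertBasis ι₂ ℂ F) :
    Cardinal.lift.{v} (Cardinal.mk ι₁) ≤ Cardinal.lift.{u} (Cardinal.mk ι₂) := by
  classical
  let c : ι₁ → ι₂ → (A → ℕ) → ℝ := fun j b k =>
    ‖inner ℂ (f b) ((X (lp.single 2 0 (e j))) k)‖ ^ 2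
  have hc0 : ∀ j b k, 0 ≤ c j b k := fun j b k => by positivity
  have hnorm_e : ∀ j, ‖e j‖ = 1 := e.orthonormal.1
  have hnorm_f : ∀ b, ‖f b‖ = 1 := f.orthonormal.1
  have hortho : Orthonormal ℂ (fun p : ι₁ × (A → ℕ) => X (lp.single 2 p.2 (e p.1))) := by
    rw [orthonormal_iff_ite]
    rintro ⟨j, k⟩ ⟨j', k'⟩
    rw [LinearIsometry.inner_map_map, lp.inner_single_left]
    by_cases hk : k = k'
    · subst hk
      simp [orthonormal_iff_ite.1 e.orthonormal]
    · simp [hk]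
  refine card_lemma (fun j b => ∑' k, ENNReal.ofReal (c j b k)) ?_ ?_
  · intro j
    rw [ENNReal.tsum_comm]
    have hpars : ∀ x : F, HasSum (fun b => ‖inner ℂ (f b) x‖ ^ 2) (‖x‖ ^ 2) := by
      intro x
      have := hasSum_sq (f.repr x)
      simpa [f.repr_apply_apply, LinearIsometryEquiv.norm_map] using this
    have hs := hasSum_sq (X (lp.single 2 0 (e j)))
    calc ∑' k, ∑' b, ENNReal.ofReal (c j b k)
        = ∑' k, ENNReal.ofReal (‖(X (lp.single 2 0 (e j))) k‖ ^ 2) := by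
          refine tsum_congr fun k => ?_
          rw [← (hpars _).tsum_eq, ENNReal.ofReal_tsum_of_nonneg (fun b => hc0 j b k)
            (hpars _).summable]
      _ = ENNReal.ofReal (‖X (lp.single 2 0 (e j))‖ ^ 2) := by
          rw [← hs.tsum_eq, ENNReal.ofReal_tsum_of_nonneg (fun b => by positivity) hs.summable]
      _ = 1 := by
          rw [LinearIsometry.norm_map, lp.norm_single (by simp), hnorm_e]; simp
  · intro b
    rw [← ENNReal.tsum_prod]
    rw [ENNReal.tsum_eq_iSup_sum]
    refine iSup_le fun s => ?_
    rw [← ENNReal.ofReal_sum_of_nonneg (fun p _ => hc0 _ _ _)]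
    rw [ENNReal.ofReal_le_one]
    let K : A → ℕ := s.sup (fun p => p.2)
    have hK : ∀ p ∈ s, p.2 ≤ K := fun p hp => Finset.le_sup (f := fun p : ι₁ × (A → ℕ) => p.2) hp
    let ψ : ι₁ × (A → ℕ) → ι₁ × (A → ℕ) := fun p => (p.1, K - p.2)
    have hψ : Set.InjOn ψ s := by
      rintro ⟨j, k⟩ hp ⟨j', k'⟩ hp' h
      simp only [ψ, Prod.mk.injEq] at h
      have h1 := hK _ hp
      have h2 := hK _ hp'
      simp only at h1 h2
      rw [Prod.mk.injEq]
      refine ⟨h.1, ?_⟩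
      rw [← tsub_tsub_cancel_of_le h1, ← tsub_tsub_cancel_of_le h2, h.2]
    have hb := hortho.sum_inner_products_le (s := s.image ψ) (x := lp.single 2 K (f b))
    rw [Finset.sum_image hψ, lp.norm_single (by simp), hnorm_f, one_pow] at hb
    refine le_trans (le_of_eq ?_) hb
    refine Finset.sum_congr rfl fun p hp => ?_
    have h1 := shift_invariance X TE TF hTE hTF hX (e p.1) (K - p.2) 0 p.2
    rw [zero_add, add_tsub_cancel_of_le (hK p hp)] at h1
    simp only [c, ψ]
    rw [lp.inner_single_right, h1, norm_inner_symm]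

end dimension

section model

theorem hasSum_nested {n : ℕ} {E : Type u} [NormedAddCommGroup E] [InnerProductSpace ℂ E]
    (f : ModelSpace n E) :
    HasSum (fun k : Option (Fin n) → ℕ => ‖(f (k none)) (fun i => k (some i))‖ ^ 2)
      (‖f‖ ^ 2) := by
  have h1 : ∀ m, HasSum (fun k => ‖(f m) k‖ ^ 2) (‖f m‖ ^ 2) := fun m => hasSum_sq (f m)
  have h2 : HasSum (fun m => ‖f m‖ ^ 2) (‖f‖ ^ 2) := hasSum_sq f
  have h3 : Summable (fun p : ℕ × (Fin n → ℕ) => ‖(f p.1) p.2‖ ^ 2) := by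
    rw [summable_prod_of_nonneg (fun p => by positivity)]
    refine ⟨fun m => (h1 m).summable, ?_⟩
    simp only [(h1 _).tsum_eq]
    exact h2.summable
  have h4 : HasSum (fun p : ℕ × (Fin n → ℕ) => ‖(f p.1) p.2‖ ^ 2) (‖f‖ ^ 2) := by
    have h5 := h3.hasSum.prod_fiberwise h1
    rw [← h5.unique h2]
    exact h3.hasSum
  exact (Equiv.hasSum_iff (Equiv.piOptionEquivProd (β := fun _ : Option (Fin n) => ℕ))).2 h4

theorem exists_phi (n : ℕ) (E : Type u) [NormedAddCommGroup E] [InnerProductSpace ℂ E] :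
    ∃ Φ : ModelSpace n E ≃ₗᵢ[ℂ] lp (fun _ : Option (Fin n) → ℕ => E) 2,
      ∀ f k, (Φ f) k = (f (k none)) (fun i => k (some i)) := by
  let P0 : ModelSpace n E →ₗ[ℂ] lp (fun _ : Option (Fin n) → ℕ => E) 2 :=
    { toFun := fun f => ⟨fun k => (f (k none)) (fun i => k (some i)),
        memlp_sq _ (hasSum_nested f).summable⟩
      map_add' := fun f g => by
        ext k
        rfl
      map_smul' := fun c f => by
        ext k
        rfl }
  let P1 : ModelSpace n E →ₗᵢ[ℂ] lp (fun _ : Option (Fin n) → ℕ => E) 2 :=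
    { P0 with
      norm_map' := fun f => norm_eq_of_hasSum _ (norm_nonneg _) (hasSum_nested f) }
  have hP1 : ∀ f k, (P1 f) k = (f (k none)) (fun i => k (some i)) := fun f k => rfl
  have hsurj : Function.Surjective P1 := by
    intro g
    let e := (Equiv.piOptionEquivProd (β := fun _ : Option (Fin n) => ℕ))
    have h1 : Summable (fun p : ℕ × (Fin n → ℕ) => ‖g (e.symm p)‖ ^ 2) :=
      (Equiv.summable_iff e.symm).2 (hasSum_sq g).summable
    have h2 := (summable_prod_of_nonneg (fun p => by positivity)).1 h1
    let g1 : ∀ m : ℕ, lp (fun _ : Fin n → ℕ => E) 2 := fun m =>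
      ⟨fun k => g (e.symm (m, k)), memlp_sq _ (h2.1 m)⟩
    have h3 : ∀ m, HasSum (fun k => ‖g (e.symm (m, k))‖ ^ 2) (‖g1 m‖ ^ 2) :=
      fun m => hasSum_sq (g1 m)
    have h4 : Summable fun m => ‖g1 m‖ ^ 2 := by
      have := h2.2
      simp only [(h3 _).tsum_eq] at this
      exact this
    refine ⟨⟨g1, memlp_sq _ h4⟩, ?_⟩
    ext k
    rw [hP1]
    change g (e.symm (e k)) = g k
    rw [Equiv.symm_apply_apply]
  exact ⟨LinearIsometryEquiv.ofSurjective P1 hsurj, fun f k => rfl⟩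

/-- family of operators indexed by `Option` -/
def fam {n : ℕ} {X : Type*} (z : X) (c : Fin n → X) : Option (Fin n) → X := fun a => a.elim z c

variable {n : ℕ} {E : Type u} [NormedAddCommGroup E] [InnerProductSpace ℂ E]
  (Φ : ModelSpace n E ≃ₗᵢ[ℂ] lp (fun _ : Option (Fin n) → ℕ => E) 2)

/-- transport of an operator along `Φ` -/
def conjOp (M : ModelSpace n E →L[ℂ] ModelSpace n E) :
    lp (fun _ : Option (Fin n) → ℕ => E) 2 →L[ℂ] lp (fun _ : Option (Fin n) → ℕ => E) 2 :=
  Φ.toContinuousLinearEquiv.toContinuousLinearMap ∘L M ∘L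
    Φ.symm.toContinuousLinearEquiv.toContinuousLinearMap

theorem conjOp_apply (M : ModelSpace n E →L[ℂ] ModelSpace n E)
    (f : lp (fun _ : Option (Fin n) → ℕ => E) 2) : conjOp Φ M f = Φ (M (Φ.symm f)) := rfl

theorem conjOp_phi (M : ModelSpace n E →L[ℂ] ModelSpace n E)
    (f : ModelSpace n E) : conjOp Φ M (Φ f) = Φ (M f) := by
  rw [conjOp_apply, LinearIsometryEquiv.symm_apply_apply]

theorem fam_isSh
  (hΦ : ∀ f k, (Φ f) k = (f (k none)) (fun i => k (some i)))
  (Mz : ModelSpace n E →L[ℂ] ModelSpace n E)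
  (Mk : Fin n → (ModelSpace n E →L[ℂ] ModelSpace n E))
    (hMz : IsUnilateralShift Mz) (hMk : ∀ i, IsKappa i (Mk i))
    (a : Option (Fin n)) : IsSh a (conjOp Φ (fam Mz Mk a)) := by
  intro g k
  obtain ⟨f, rfl⟩ := Φ.surjective g
  rw [conjOp_phi, hΦ, hΦ]
  cases a with
  | none =>
    change ((Mz f) (k none)) _ = _
    rcases hk : k none with _ | m
    · rw [(hMz f).1]; simp
    · rw [(hMz f).2]; simp
  | some i =>
    change ((Mk i f) (k none)) _ = _
    rw [hMk i]
    congr 1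
    rw [Function.update_of_ne (by simp)]
    refine congrArg _ ?_
    funext j
    by_cases hj : j = i
    · subst hj; simp
    · rw [Function.update_of_ne hj, Function.update_of_ne (by simpa using hj)]

theorem exists_ops
  (hΦ : ∀ f k, (Φ f) k = (f (k none)) (fun i => k (some i))) : ∃ (Mz : ModelSpace n E →L[ℂ] ModelSpace n E)
    (Mk : Fin n → (ModelSpace n E →L[ℂ] ModelSpace n E)),
    IsUnilateralShift Mz ∧ ∀ i, IsKappa i (Mk i) := by
  choose T hT using exists_sh (A := Option (Fin n)) E
  let Q : Option (Fin n) → (ModelSpace n E →L[ℂ] ModelSpace n E) := fun a =>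
    Φ.symm.toContinuousLinearEquiv.toContinuousLinearMap ∘L T a ∘L
    Φ.toContinuousLinearEquiv.toContinuousLinearMap
  have hQ : ∀ a f, Φ (Q a f) = T a (Φ f) := fun a f => Φ.apply_symm_apply _
  let kk : ℕ → (Fin n → ℕ) → Option (Fin n) → ℕ := fun m k a => a.elim m k
  have hcoord : ∀ (f : ModelSpace n E) m k, (f m) k = (Φ f) (kk m k) := by
    intro f m k
    rw [hΦ]
    rfl
  refine ⟨Q none, fun i => Q (some i), ?_, ?_⟩
  · intro f
    constructor
    · ext k
      rw [hcoord, hQ, (hT none).zero _ _ rfl]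
      rfl
    · intro m
      ext k
      rw [hcoord, hQ, hcoord, hT none, if_pos (by simp [kk])]
      refine congrArg _ ?_
      funext a
      cases a <;> simp [kk]
  · intro i f m k
    rw [hcoord, hQ, hcoord, hT (some i)]
    congr 1
    refine congrArg _ ?_
    funext a
    rcases a with _ | j
    · simp [kk]
    · by_cases hj : j = i
      · subst hj; simp [kk]
      · rw [Function.update_of_ne (by simpa using hj)]
        simp [kk, hj]

end model

section core

variable {A : Type*} [Fintype A] [DecidableEq A]

theorem core_wold {F : Type u} [NormedAddCommGroup F] [InnerProductSpace ℂ F] [CompleteSpace F]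
    {H : Type u} [NormedAddCommGroup H] [InnerProductSpace ℂ H] [CompleteSpace H]
    (V : A → H →L[ℂ] H)
    (T : A → lp (fun _ : A → ℕ => F) 2 →L[ℂ] lp (fun _ : A → ℕ => F) 2)
    (hT : ∀ a, IsSh a (T a)) (ψ : H →ₗᵢ[ℂ] lp (fun _ : A → ℕ => F) 2)
    (hψ : ∀ a f, ψ (V a f) = T a (ψ f))
    (hdc : ∀ a b, a ≠ b → ∀ f, adjoint (V a) (V b f) = V b (adjoint (V a) f)) :
    ∃ (ι : Type u) (X : lp (fun _ : A → ℕ => lp (fun _ : ι => ℂ) 2) 2 →ₗᵢ[ℂ] H),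
      Function.Surjective X ∧
      (∀ (TE : A → (lp (fun _ : A → ℕ => lp (fun _ : ι => ℂ) 2) 2 →L[ℂ]
        lp (fun _ : A → ℕ => lp (fun _ : ι => ℂ) 2) 2)), (∀ a, IsSh a (TE a)) →
        ∀ a f, X (TE a f) = V a (X f)) := by
  have hpow : ∀ a (N : ℕ) f, ψ ((V a ^ N) f) = (T a ^ N) (ψ f) := by
    intro a N f
    induction N with
    | zero => simp
    | succ N ih => rw [pow_succ', pow_succ', mulA, mulA, hψ, ih]
  obtain ⟨ι, X, hX, hXT⟩ := wold V
    (fun a f => by rw [← ψ.norm_map, hψ, (hT a).norm, ψ.norm_map])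
    (fun a b => by
      ext f
      apply ψ.injective
      rw [mulA, mulA, hψ, hψ, hψ, hψ, (hT a).comm (hT b)])
    hdc
    (fun a g ε hε => by
      obtain ⟨N, hN⟩ := (hT a).pure (ψ g) ε hε
      refine ⟨N, fun y => ?_⟩
      rw [← ψ.inner_map_map, hpow, ← ψ.norm_map y]
      exact hN _)
  exact ⟨ι, X, hX, fun TE hTE a f => hXT TE (fun a k x => (hTE a).single k x) a f⟩

theorem core_dc {E : Type*} [NormedAddCommGroup E] [InnerProductSpace ℂ E]
    {H : Type*} [NormedAddCommGroup H] [InnerProductSpace ℂ H] [CompleteSpace H]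
    (V : A → H →L[ℂ] H)
    (T : A → lp (fun _ : A → ℕ => E) 2 →L[ℂ] lp (fun _ : A → ℕ => E) 2)
    (hT : ∀ a, IsSh a (T a)) (X : lp (fun _ : A → ℕ => E) 2 →ₗᵢ[ℂ] H)
    (hX : ∀ a f, X (T a f) = V a (X f)) (hs : Function.Surjective X) (a b : A) (hab : a ≠ b)
    (f : H) : adjoint (V a) (V b f) = V b (adjoint (V a) f) := by
  refine dc_of_ker ?_ ?_ ?_ f
  · intro f
    obtain ⟨f, rfl⟩ := hs f
    rw [← hX, X.norm_map, X.norm_map, (hT a).norm]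
  · intro f
    obtain ⟨f, rfl⟩ := hs f
    rw [← hX, ← hX, ← hX, ← hX, (hT a).comm (hT b)]
  · intro f hf
    obtain ⟨f, rfl⟩ := hs f
    rw [adjoint_eq_zero_iff] at hf ⊢
    intro g
    obtain ⟨g, rfl⟩ := hs g
    rw [← hX, ← hX, X.inner_map_map]
    refine (hT a).ker hab (hT b) f (fun g => ?_) g
    rw [← X.inner_map_map, hX]
    exact hf _

end core

end DCWold

set_option maxHeartbeats 4000000 in
set_option synthInstance.maxHeartbeats 1000000 in
/-- An invariant subspace `S ⊆ ℓ²(ℕ, ℓ²(ℕⁿ, F))` is doubly commuting (i.e. the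
restricted tuple `(M_z|_S, M_{κ₁}|_S, …, M_{κₙ}|_S)` is doubly commuting) iff there are a Hilbert
space `E` (realized as `ℓ²(ι, ℂ)` for some index type `ι`) and an isometric module map
`X : ℓ²(ℕ, ℓ²(ℕⁿ, E)) → ℓ²(ℕ, ℓ²(ℕⁿ, F))` with range `S`; moreover in that case
`dim E ≤ dim F`. -/
theorem statement15 (n : ℕ) (hn : 1 ≤ n)
    (F : Type u) [NormedAddCommGroup F] [InnerProductSpace ℂ F] [CompleteSpace F]
    (MzF : ModelSpace n F →L[ℂ] ModelSpace n F) (hMzF : IsUnilateralShift MzF)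
    (MkF : Fin n → (ModelSpace n F →L[ℂ] ModelSpace n F)) (hMkF : ∀ i, IsKappa i (MkF i))
    (S : Submodule ℂ (ModelSpace n F)) (hScl : IsClosed (S : Set (ModelSpace n F)))
    [CompleteSpace ↥S]
    (hSz : ∀ f ∈ S, MzF f ∈ S) (hSk : ∀ i, ∀ f ∈ S, MkF i f ∈ S)
    (V : ↥S →L[ℂ] ↥S) (hV : ∀ f : ↥S, (V f : ModelSpace n F) = MzF ↑f)
    (Vc : Fin n → (↥S →L[ℂ] ↥S))
    (hVc : ∀ (i : Fin n) (f : ↥S), (Vc i f : ModelSpace n F) = MkF i ↑f) :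
    (((∀ i, ContinuousLinearMap.adjoint V ∘L Vc i = Vc i ∘L ContinuousLinearMap.adjoint V) ∧
        (∀ i j, i ≠ j →
          ContinuousLinearMap.adjoint (Vc i) ∘L Vc j =
            Vc j ∘L ContinuousLinearMap.adjoint (Vc i))) ↔
      (∃ (ι : Type u)
          (MzE : ModelSpace n (lp (fun _ : ι => ℂ) 2) →L[ℂ] ModelSpace n (lp (fun _ : ι => ℂ) 2))
          (MkE : Fin n →
            (ModelSpace n (lp (fun _ : ι => ℂ) 2) →L[ℂ] ModelSpace n (lp (fun _ : ι => ℂ) 2)))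
          (X : ModelSpace n (lp (fun _ : ι => ℂ) 2) →ₗᵢ[ℂ] ModelSpace n F),
        IsUnilateralShift MzE ∧ (∀ i, IsKappa i (MkE i)) ∧
        (∀ f, X (MzE f) = MzF (X f)) ∧
        (∀ (i : Fin n) f, X (MkE i f) = MkF i (X f)) ∧
        Set.range X = (S : Set (ModelSpace n F)))) ∧
    (∀ (ι : Type u)
        (MzE : ModelSpace n (lp (fun _ : ι => ℂ) 2) →L[ℂ] ModelSpace n (lp (fun _ : ι => ℂ) 2))
        (MkE : Fin n →
          (ModelSpace n (lp (fun _ : ι => ℂ) 2) →L[ℂ] ModelSpace n (lp (fun _ : ι => ℂ) 2)))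
        (X : ModelSpace n (lp (fun _ : ι => ℂ) 2) →ₗᵢ[ℂ] ModelSpace n F),
      IsUnilateralShift MzE → (∀ i, IsKappa i (MkE i)) →
      (∀ f, X (MzE f) = MzF (X f)) →
      (∀ (i : Fin n) f, X (MkE i f) = MkF i (X f)) →
      Set.range X = (S : Set (ModelSpace n F)) →
      HilbertDimLE (lp (fun _ : ι => ℂ) 2) F) := by
  obtain ⟨ΦF, hΦF⟩ := DCWold.exists_phi n F
  have hTF := DCWold.fam_isSh ΦF hΦF MzF MkF hMzF hMkF
  have hVa : ∀ a (f : ↥S), (DCWold.fam V Vc a f : ModelSpace n F) =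
      DCWold.fam MzF MkF a (f : ModelSpace n F) := by
    intro a f
    cases a with
    | none => exact hV f
    | some i => exact hVc i f
  have hfamX : ∀ (ι : Type u)
      (MzE : ModelSpace n (lp (fun _ : ι => ℂ) 2) →L[ℂ] ModelSpace n (lp (fun _ : ι => ℂ) 2))
      (MkE : Fin n →
        (ModelSpace n (lp (fun _ : ι => ℂ) 2) →L[ℂ] ModelSpace n (lp (fun _ : ι => ℂ) 2)))
      (X : ModelSpace n (lp (fun _ : ι => ℂ) 2) →ₗᵢ[ℂ] ModelSpace n F),
      (∀ f, X (MzE f) = MzF (X f)) → (∀ (i : Fin n) f, X (MkE i f) = MkF i (X f)) →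
      ∀ a f, X (DCWold.fam MzE MkE a f) = DCWold.fam MzF MkF a (X f) := by
    intro ι MzE MkE X h1 h2 a f
    cases a with
    | none => exact h1 f
    | some i => exact h2 i f
  refine ⟨⟨?_, ?_⟩, ?_⟩
  · rintro ⟨hd1, hd2⟩
    have hd1' : ∀ i, adjoint (Vc i) ∘L V = V ∘L adjoint (Vc i) := by
      intro i
      have := congrArg adjoint (hd1 i)
      rw [adjoint_comp, adjoint_comp, adjoint_adjoint] at this
      exact this
    have hdc : ∀ a b, a ≠ b → ∀ f, adjoint (DCWold.fam V Vc a) (DCWold.fam V Vc b f) =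
        DCWold.fam V Vc b (adjoint (DCWold.fam V Vc a) f) := by
      intro a b hab f
      rcases a with _ | i <;> rcases b with _ | j
      · exact absurd rfl hab
      · exact congrArg (fun T : ↥S →L[ℂ] ↥S => T f) (hd1 j)
      · exact congrArg (fun T : ↥S →L[ℂ] ↥S => T f) (hd1' i)
      · exact congrArg (fun T : ↥S →L[ℂ] ↥S => T f) (hd2 i j (fun h => hab (by rw [h])))
    obtain ⟨ι, X, hXs, hXT⟩ := DCWold.core_wold (DCWold.fam V Vc)
      (fun a => DCWold.conjOp ΦF (DCWold.fam MzF MkF a)) hTF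
      (ΦF.toLinearIsometry.comp S.subtypeₗᵢ)
      (fun a f => by
        change ΦF (DCWold.fam V Vc a f : ModelSpace n F) =
          DCWold.conjOp ΦF (DCWold.fam MzF MkF a) (ΦF (f : ModelSpace n F))
        rw [DCWold.conjOp_phi, hVa]) hdc
    obtain ⟨ΦE, hΦE⟩ := DCWold.exists_phi n (lp (fun _ : ι => ℂ) 2)
    obtain ⟨MzE, MkE, hMzE, hMkE⟩ := DCWold.exists_ops ΦE hΦE
    have hTE := DCWold.fam_isSh ΦE hΦE MzE MkE hMzE hMkE
    have hX2 : ∀ a f, ((X (ΦE (DCWold.fam MzE MkE a f)) : ↥S) : ModelSpace n F) =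
        DCWold.fam MzF MkF a (X (ΦE f) : ↥S) := by
      intro a f
      rw [← DCWold.conjOp_phi, hXT _ hTE, hVa]
    refine ⟨ι, MzE, MkE, S.subtypeₗᵢ.comp (X.comp ΦE.toLinearIsometry), hMzE, hMkE,
      fun f => hX2 none f, fun i f => hX2 (some i) f, ?_⟩
    ext g
    constructor
    · rintro ⟨f, rfl⟩
      exact (X (ΦE f)).2
    · intro hg
      obtain ⟨f, hf⟩ := hXs ⟨g, hg⟩
      refine ⟨ΦE.symm f, ?_⟩
      change ((X (ΦE (ΦE.symm f)) : ↥S) : ModelSpace n F) = g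
      rw [LinearIsometryEquiv.apply_symm_apply, hf]
  · rintro ⟨ι, MzE, MkE, X, hMzE, hMkE, hXz, hXk, hXr⟩
    obtain ⟨ΦE, hΦE⟩ := DCWold.exists_phi n (lp (fun _ : ι => ℂ) 2)
    have hTE := DCWold.fam_isSh ΦE hΦE MzE MkE hMzE hMkE
    have hXa := hfamX ι MzE MkE X hXz hXk
    have hmem : ∀ f, X f ∈ S := fun f => by
      have : X f ∈ Set.range X := ⟨f, rfl⟩
      rw [hXr] at this
      exact this
    let Y : lp (fun _ : Option (Fin n) → ℕ => lp (fun _ : ι => ℂ) 2) 2 →ₗᵢ[ℂ] ↥S :=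
      { toLinearMap := (X.toLinearMap.codRestrict S hmem) ∘ₗ
          ΦE.symm.toLinearEquiv.toLinearMap
        norm_map' := fun f => by
          change ‖X (ΦE.symm f)‖ = ‖f‖
          rw [X.norm_map, LinearIsometryEquiv.norm_map] }
    have hY : ∀ f, (Y f : ModelSpace n F) = X (ΦE.symm f) := fun f => rfl
    have hdc := DCWold.core_dc (DCWold.fam V Vc)
      (fun a => DCWold.conjOp ΦE (DCWold.fam MzE MkE a)) hTE Y
      (fun a f => by
        apply Subtype.ext
        rw [hY, hVa, hY, DCWold.conjOp_apply, LinearIsometryEquiv.symm_apply_apply, hXa])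
      (fun g => by
        have hg : (g : ModelSpace n F) ∈ Set.range X := by rw [hXr]; exact g.2
        obtain ⟨f, hf⟩ := hg
        refine ⟨ΦE f, Subtype.ext ?_⟩
        rw [hY, LinearIsometryEquiv.symm_apply_apply, hf])
    refine ⟨fun i => ?_, fun i j hij => ?_⟩
    · exact ContinuousLinearMap.ext fun f => hdc none (some i) (by simp) f
    · exact ContinuousLinearMap.ext fun f => hdc (some i) (some j) (by simpa using hij) f
  · intro ι MzE MkE X hMzE hMkE hXz hXk _ ι₁ ι₂ e f
    obtain ⟨ΦE, hΦE⟩ := DCWold.exists_phi n (lp (fun _ : ι => ℂ) 2)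
    have hTE := DCWold.fam_isSh ΦE hΦE MzE MkE hMzE hMkE
    have hXa := hfamX ι MzE MkE X hXz hXk
    refine DCWold.dim_le (ΦF.toLinearIsometry.comp (X.comp ΦE.symm.toLinearIsometry))
      (fun a => DCWold.conjOp ΦE (DCWold.fam MzE MkE a))
      (fun a => DCWold.conjOp ΦF (DCWold.fam MzF MkF a)) hTE hTF ?_ e f
    intro a g
    change ΦF (X (ΦE.symm (DCWold.conjOp ΦE (DCWold.fam MzE MkE a) g))) =
      DCWold.conjOp ΦF (DCWold.fam MzF MkF a) (ΦF (X (ΦE.symm g)))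
    rw [DCWold.conjOp_phi, DCWold.conjOp_apply, LinearIsometryEquiv.symm_apply_apply, hXa]
end
end
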